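/- Let d ≥ 1 and k ≥ 0 be integers and α ∈ [0,1] with k + α > 0. Then the Hausdorff order of the space 𝓕^{d,k,α} endowed with the C^0 sup-norm satisfies ord_H 𝓕^{d,k,α} ≥ d/(k + α). -/

import Mathlib

open Filter MeasureTheory Metric Set
open scoped ENNReal Topology NNReal

noncomputable section

/-- A *scaling* is a family `(s α)_{α>0}` of positive non-decreasing functions on `(0,1)`
such that for all `α > β > 0` there is `λ₀ > 1` with, for every `λ ∈ (1, λ₀)`,
`s α ε / s β (ε^λ) → 0` and `s α ε / (s β ε)^λ → 0` as `ε → 0⁺`. -/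
def IsScaling (s : ℝ → ℝ → ℝ) : Prop :=
  (∀ α : ℝ, 0 < α → ∀ ε ∈ Set.Ioo (0:ℝ) 1, 0 < s α ε) ∧
  (∀ α : ℝ, 0 < α → MonotoneOn (s α) (Set.Ioo (0:ℝ) 1)) ∧
  (∀ α β : ℝ, 0 < β → β < α → ∃ l₀ > (1:ℝ), ∀ l ∈ Set.Ioo (1:ℝ) l₀,
    Tendsto (fun ε : ℝ => s α ε / s β (ε ^ l)) (𝓝[>] (0:ℝ)) (𝓝 0) ∧
    Tendsto (fun ε : ℝ => s α ε / (s β ε) ^ l) (𝓝[>] (0:ℝ)) (𝓝 0))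

/-- The covering number `N_ε(E)`: minimal cardinality of a finite cover of `E` by balls of
radius `ε` centered in `E` (`+∞` if there is no such finite cover). -/
def coveringNumber {X : Type*} [MetricSpace X] (E : Set X) (ε : ℝ) : ℝ≥0∞ :=
  ⨅ (t : Finset X) (_ : (↑t : Set X) ⊆ E ∧ E ⊆ ⋃ x ∈ t, ball x ε), (t.card : ℝ≥0∞)

/-- Lower box scale of a set. -/
def lowerBoxScale {X : Type*} [MetricSpace X] (s : ℝ → ℝ → ℝ) (E : Set X) : ℝ≥0∞ :=
  ⨆ (α : ℝ) (_ : 0 < α ∧ Tendsto (fun ε : ℝ => coveringNumber E ε * ENNReal.ofReal (s α ε))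
      (𝓝[>] (0:ℝ)) (𝓝 (⊤ : ℝ≥0∞))), ENNReal.ofReal α

/-- Upper box scale of a set. -/
def upperBoxScale {X : Type*} [MetricSpace X] (s : ℝ → ℝ → ℝ) (E : Set X) : ℝ≥0∞ :=
  ⨅ (α : ℝ) (_ : 0 < α ∧ Tendsto (fun ε : ℝ => coveringNumber E ε * ENNReal.ofReal (s α ε))
      (𝓝[>] (0:ℝ)) (𝓝 (0 : ℝ≥0∞))), ENNReal.ofReal α

/-- `H_ε^φ(E)`: Hausdorff pre-measure at scale `ε`, via countable covers by balls of radii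
at most `ε`. -/
def hausdorffPre {X : Type*} [MetricSpace X] (φ : ℝ → ℝ) (E : Set X) (ε : ℝ) : ℝ≥0∞ :=
  ⨅ (c : ℕ → X) (r : ℕ → ℝ) (t : Set ℕ)
    (_ : (∀ n ∈ t, r n ∈ Set.Ioc (0:ℝ) ε) ∧ E ⊆ ⋃ n ∈ t, ball (c n) (r n)),
    ∑' n : t, ENNReal.ofReal (φ (r n))

/-- `H^φ(E) = lim_{ε→0} H_ε^φ(E)`. -/
def hausdorffMeasureOf {X : Type*} [MetricSpace X] (φ : ℝ → ℝ) (E : Set X) : ℝ≥0∞ :=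
  ⨆ (ε : ℝ) (_ : 0 < ε), hausdorffPre φ E ε

/-- Hausdorff scale of a set. -/
def hausdorffScale {X : Type*} [MetricSpace X] (s : ℝ → ℝ → ℝ) (E : Set X) : ℝ≥0∞ :=
  ⨆ (α : ℝ) (_ : 0 < α ∧ hausdorffMeasureOf (s α) E = ⊤), ENNReal.ofReal α

/-- Packing scale of a set, via countable covers and upper box scales. -/
def packingScale {X : Type*} [MetricSpace X] (s : ℝ → ℝ → ℝ) (A : Set X) : ℝ≥0∞ :=
  ⨅ (E : ℕ → Set X) (_ : (⋃ n, E n) = A), ⨆ n, upperBoxScale s (E n)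

/-- Lower local scale of a measure at a point. -/
def lowerLocalScale {X : Type*} [MetricSpace X] [MeasurableSpace X]
    (s : ℝ → ℝ → ℝ) (μ : Measure X) (x : X) : ℝ≥0∞ :=
  ⨆ (α : ℝ) (_ : 0 < α ∧ Tendsto (fun ε : ℝ => μ (ball x ε) / ENNReal.ofReal (s α ε))
      (𝓝[>] (0:ℝ)) (𝓝 (0 : ℝ≥0∞))), ENNReal.ofReal α

/-- Upper local scale of a measure at a point. -/
def upperLocalScale {X : Type*} [MetricSpace X] [MeasurableSpace X]
    (s : ℝ → ℝ → ℝ) (μ : Measure X) (x : X) : ℝ≥0∞ :=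
  ⨅ (α : ℝ) (_ : 0 < α ∧ Tendsto (fun ε : ℝ => μ (ball x ε) / ENNReal.ofReal (s α ε))
      (𝓝[>] (0:ℝ)) (𝓝 (⊤ : ℝ≥0∞))), ENNReal.ofReal α

/-- Scale of a measure: infimum of the scale over Borel sets of positive measure. -/
def measureScale {X : Type*} [MetricSpace X] [MeasurableSpace X]
    (sc : Set X → ℝ≥0∞) (μ : Measure X) : ℝ≥0∞ :=
  ⨅ (E : Set X) (_ : MeasurableSet E ∧ 0 < μ E), sc E

/-- `*`-scale of a measure: infimum of the scale over Borel sets of full measure. -/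
def measureScaleStar {X : Type*} [MetricSpace X] [MeasurableSpace X]
    (sc : Set X → ℝ≥0∞) (μ : Measure X) : ℝ≥0∞ :=
  ⨅ (E : Set X) (_ : MeasurableSet E ∧ μ Eᶜ = 0), sc E

/-- Quantization number `Q_μ(ε)`. -/
def quantizationNumber {X : Type*} [MetricSpace X] [MeasurableSpace X]
    (μ : Measure X) (ε : ℝ) : ℝ≥0∞ :=
  ⨅ (t : Finset X) (_ : ∫⁻ x, (⨅ c ∈ t, edist x c) ∂μ ≤ ENNReal.ofReal ε), (t.card : ℝ≥0∞)

/-- Lower quantization scale of a measure. -/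
def lowerQuantScale {X : Type*} [MetricSpace X] [MeasurableSpace X]
    (s : ℝ → ℝ → ℝ) (μ : Measure X) : ℝ≥0∞ :=
  ⨆ (α : ℝ) (_ : 0 < α ∧ Tendsto (fun ε : ℝ => quantizationNumber μ ε * ENNReal.ofReal (s α ε))
      (𝓝[>] (0:ℝ)) (𝓝 (⊤ : ℝ≥0∞))), ENNReal.ofReal α

/-- Upper quantization scale of a measure. -/
def upperQuantScale {X : Type*} [MetricSpace X] [MeasurableSpace X]
    (s : ℝ → ℝ → ℝ) (μ : Measure X) : ℝ≥0∞ :=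
  ⨅ (α : ℝ) (_ : 0 < α ∧ Tendsto (fun ε : ℝ => quantizationNumber μ ε * ENNReal.ofReal (s α ε))
      (𝓝[>] (0:ℝ)) (𝓝 (0 : ℝ≥0∞))), ENNReal.ofReal α

/-- Packing number `Ñ_ε(E)`: maximal cardinality of an `ε`-separated subset of `E`. -/
def packingNumber {X : Type*} [MetricSpace X] (E : Set X) (ε : ℝ) : ℝ≥0∞ :=
  ⨆ (t : Finset X) (_ : (↑t : Set X) ⊆ E ∧ ∀ x ∈ t, ∀ y ∈ t, x ≠ y → ε ≤ dist x y),
    (t.card : ℝ≥0∞)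

/-- `P_ε^φ(E)`: supremum of `Σ φ(r_i)` over `ε`-packs of `E` (pairwise disjoint balls of `E`,
centered in `E`, with radii at most `ε`). -/
def packingPre {X : Type*} [MetricSpace X] (φ : ℝ → ℝ) (E : Set X) (ε : ℝ) : ℝ≥0∞ :=
  ⨆ (t : Finset (X × ℝ)) (_ : (∀ p ∈ t, p.1 ∈ E ∧ p.2 ∈ Set.Ioc (0:ℝ) ε) ∧
      (↑t : Set (X × ℝ)).Pairwise fun p q => Disjoint (ball p.1 p.2 ∩ E) (ball q.1 q.2 ∩ E)),
    ∑ p ∈ t, ENNReal.ofReal (φ p.2)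

/-- The packing pre-measure `P_0^φ(E) = lim_{ε→0} P_ε^φ(E)`. -/
def packingPre0 {X : Type*} [MetricSpace X] (φ : ℝ → ℝ) (E : Set X) : ℝ≥0∞ :=
  ⨅ (ε : ℝ) (_ : 0 < ε), packingPre φ E ε

/-- The packing `φ`-measure `P^φ(E)`. -/
def packingMeasureOf {X : Type*} [MetricSpace X] (φ : ℝ → ℝ) (E : Set X) : ℝ≥0∞ :=
  ⨅ (F : ℕ → Set X) (_ : (⋃ n, F n) = E), ∑' n, packingPre0 φ (F n)



/-- The unit cube `[0,1]^d`. -/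
abbrev Cube (d : ℕ) : Set (Fin d → ℝ) := Set.Icc 0 1

instance (d : ℕ) : CompactSpace (Cube d) := isCompact_iff_compactSpace.mp isCompact_Icc

/-- The functions `f : [0,1]^d → [-1,1]` of class `C^k` with `‖f‖_{C^k} ≤ 1` and,
when `α > 0`, with `D^k f` `α`-Hölder of constant `1`. -/
def FSet (d k : ℕ) (α : ℝ) : Set ((Fin d → ℝ) → ℝ) :=
  {f | ContDiffOn ℝ k f (Cube d) ∧
    (∀ x ∈ Cube d, f x ∈ Set.Icc (-1 : ℝ) 1) ∧
    (∀ j : ℕ, j ≤ k → ∀ x ∈ Cube d, ‖iteratedFDerivWithin ℝ j f (Cube d) x‖ ≤ 1) ∧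
    (0 < α → ∀ x ∈ Cube d, ∀ y ∈ Cube d,
      ‖iteratedFDerivWithin ℝ k f (Cube d) x - iteratedFDerivWithin ℝ k f (Cube d) y‖ ≤
        ‖x - y‖ ^ α)}

/-- The space `𝓕^{d,k,α}`, realized inside `C([0,1]^d, ℝ)` with the sup metric. -/
def FSpace (d k : ℕ) (α : ℝ) : Set C(Cube d, ℝ) :=
  {g | ∃ f ∈ FSet d k α, ∀ x : Cube d, g x = f x}

/-- The `ord` scaling `ε ↦ exp (-ε^{-α})`. -/
def ordFam : ℝ → ℝ → ℝ := fun α ε => Real.exp (-(ε ^ (-α)))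

/-- Mass distribution principle for a Cantor-like subset. -/
theorem aux_mass {X : Type*} [MetricSpace X] (E : Set X) (φ : ℝ → ℝ)
    (Y : ℕ → Type) [∀ n, Fintype (Y n)] [∀ n, Nonempty (Y n)]
    (F : (∀ n, Y n) → X) (hF : ∀ w, F w ∈ E) (c ρ : ℝ) (hc : 0 < c) (hρ : 0 < ρ) (hρ1 : ρ < 1)
    (hsep : ∀ w w' : (∀ n, Y n), ∀ m, w m ≠ w' m → c * ρ ^ m / 2 ≤ dist (F w) (F w'))
    (hcard : ∀ A : ℝ, 0 < A → ∀ᶠ m : ℕ in atTop, ∀ r : ℝ, c * ρ ^ (m + 1) / 4 < r →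
      A ≤ Fintype.card (Y m) * φ r) :
    hausdorffMeasureOf φ E = ⊤ := by
  classical
  let _ : ∀ n, MeasurableSpace (Y n) := fun n => ⊤
  let μ : Measure (∀ n, Y n) :=
    Measure.infinitePi (fun n => (PMF.uniformOfFintype (Y n)).toMeasure)
  have hμ1 : μ univ = 1 := measure_univ
  have hcyl : ∀ m (η : Y m), μ {w | w m = η} = (Fintype.card (Y m) : ℝ≥0∞)⁻¹ := by
    intro m η
    have h0 : ∃ w0 : (∀ n, Y n), w0 m = η := by
      refine ⟨Function.update (fun n => Classical.arbitrary _) m η, by simp⟩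
    obtain ⟨w0, rfl⟩ := h0
    have h1 : {w : (∀ n, Y n) | w m = w0 m} = Set.pi (({m} : Finset ℕ) : Set ℕ) (fun n => {w0 n}) := by
      ext w; simp
    rw [h1, Measure.infinitePi_pi]
    · rw [Finset.prod_singleton, PMF.toMeasure_apply_singleton _ _ (by trivial),
        PMF.uniformOfFintype_apply]
    · intro i _; trivial
  have key : ∀ A : ℝ, 0 < A → ENNReal.ofReal A ≤ hausdorffMeasureOf φ E := by
    intro A hA
    obtain ⟨m0, hm0⟩ := eventually_atTop.1 (hcard A hA)
    have hε : 0 < c * ρ ^ m0 / 4 := by positivity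
    refine le_trans ?_ (le_iSup₂ (f := fun (ε : ℝ) (_ : 0 < ε) => hausdorffPre φ E ε) _ hε)
    unfold hausdorffPre
    refine le_iInf fun x => le_iInf fun r => le_iInf fun t => le_iInf fun ht => ?_
    obtain ⟨hr, hcov⟩ := ht
    have hball : ∀ n : t, ENNReal.ofReal A * μ (F ⁻¹' ball (x n) (r n)) ≤ ENNReal.ofReal (φ (r n)) := by
      rintro ⟨n, hn⟩
      obtain ⟨hr0, hr1⟩ := hr n hn
      simp only
      have hx1 : 4 * r n / c ≤ ρ ^ m0 := by
        rw [div_le_iff₀ hc]; linarith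
      obtain ⟨m, hm1, hm2⟩ := exists_nat_pow_near_of_lt_one (x := 4 * r n / c) (y := ρ)
        (by positivity) (hx1.trans (pow_le_one₀ hρ.le hρ1.le)) hρ hρ1
      have hmm : m0 ≤ m := by
        have := (pow_lt_pow_iff_right_of_lt_one₀ hρ hρ1).1 (hm1.trans_le hx1)
        omega
      rw [lt_div_iff₀ hc] at hm1
      rw [div_le_iff₀ hc] at hm2
      have hA2 := hm0 m hmm (r n) (by linarith)
      have hcp : (0 : ℝ) < Fintype.card (Y m) := by exact_mod_cast Fintype.card_pos
      have hle : μ (F ⁻¹' ball (x n) (r n)) ≤ (Fintype.card (Y m) : ℝ≥0∞)⁻¹ := by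
        rcases (F ⁻¹' ball (x n) (r n)).eq_empty_or_nonempty with he | ⟨w, hw⟩
        · rw [he]; simp
        · rw [← hcyl m (w m)]
          refine measure_mono fun w' hw' => ?_
          by_contra hne
          have h1 := hsep w' w m hne
          have h2 : dist (F w') (F w) < r n + r n :=
            lt_of_le_of_lt (dist_triangle_right _ _ (x n)) (add_lt_add hw' hw)
          linarith
      calc ENNReal.ofReal A * μ (F ⁻¹' ball (x n) (r n))
          ≤ ENNReal.ofReal A * (Fintype.card (Y m) : ℝ≥0∞)⁻¹ := by gcongr
        _ = ENNReal.ofReal (A / Fintype.card (Y m)) := by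
            rw [ENNReal.ofReal_div_of_pos hcp, ENNReal.ofReal_natCast, div_eq_mul_inv]
        _ ≤ ENNReal.ofReal (φ (r n)) := by
            apply ENNReal.ofReal_le_ofReal
            rw [div_le_iff₀ hcp]; linarith
    have huniv : (univ : Set (∀ n, Y n)) ⊆ ⋃ n : t, F ⁻¹' ball (x n) (r n) := by
      intro w _
      have := hcov (hF w)
      simp only [mem_iUnion] at this ⊢
      obtain ⟨n, hn, h⟩ := this
      exact ⟨⟨n, hn⟩, h⟩
    calc ENNReal.ofReal A = ENNReal.ofReal A * μ univ := by rw [hμ1, mul_one]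
      _ ≤ ENNReal.ofReal A * ∑' n : t, μ (F ⁻¹' ball (x n) (r n)) := by
          gcongr
          exact (measure_mono huniv).trans (measure_iUnion_le _)
      _ = ∑' n : t, ENNReal.ofReal A * μ (F ⁻¹' ball (x n) (r n)) := ENNReal.tsum_mul_left.symm
      _ ≤ _ := ENNReal.tsum_le_tsum hball
  refine ENNReal.eq_top_of_forall_nnreal_le fun A => ?_
  refine le_trans ?_ (key (A + 1) (by positivity))
  rw [← ENNReal.ofReal_coe_nnreal]
  exact ENNReal.ofReal_le_ofReal (by linarith)

/-- The fixed bump. -/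
def auxBump (d : ℕ) : ContDiffBump (0 : Fin d → ℝ) := ⟨1/6, 1/3, by norm_num, by norm_num⟩

theorem auxBump_bound (d j : ℕ) : ∃ M : ℝ, ∀ x, ‖iteratedFDeriv ℝ j (auxBump d) x‖ ≤ M := by
  have h1 : HasCompactSupport (iteratedFDeriv ℝ j (auxBump d)) :=
    (auxBump d).hasCompactSupport.iteratedFDeriv j
  have h2 : Continuous (iteratedFDeriv ℝ j (auxBump d)) :=
    ((auxBump d).contDiff (n := j)).continuous_iteratedFDeriv le_rfl
  exact h1.exists_bound_of_continuous h2

/-- sum of separated bumps -/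
def auxSum {d : ℕ} {ι : Type} [Fintype ι] (p : ι → Fin d → ℝ) (s : ι → ℝ) (y : Fin d → ℝ) : ℝ :=
  ∑ i, s i • auxBump d (y - p i)

theorem auxSum_contDiff {d : ℕ} {ι : Type} [Fintype ι] (p : ι → Fin d → ℝ) (s : ι → ℝ)
    (n : ℕ∞) : ContDiff ℝ n (auxSum p s) := by
  unfold auxSum
  refine ContDiff.sum fun i _ => ?_
  refine ContDiff.const_smul _ ?_
  exact (auxBump d).contDiff.comp (contDiff_id.sub contDiff_const)

theorem auxSum_bound {d : ℕ} {ι : Type} [Fintype ι] (p : ι → Fin d → ℝ) (s : ι → ℝ)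
    (hp : ∀ i j, i ≠ j → 1 ≤ dist (p i) (p j)) (hs : ∀ i, |s i| ≤ 1) (j : ℕ) (M : ℝ)
    (hM : ∀ x, ‖iteratedFDeriv ℝ j (auxBump d) x‖ ≤ M) (y : Fin d → ℝ) :
    ‖iteratedFDeriv ℝ j (auxSum p s) y‖ ≤ M := by
  classical
  have hM0 : 0 ≤ M := (norm_nonneg _).trans (hM 0)
  have hcd : ∀ i, ContDiff ℝ j (fun y => auxBump d (y - p i)) := fun i =>
    (auxBump d).contDiff.comp (contDiff_id.sub contDiff_const)
  have h1 : iteratedFDeriv ℝ j (auxSum p s) y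
      = ∑ i, s i • iteratedFDeriv ℝ j (auxBump d) (y - p i) := by
    have : auxSum p s = fun y => ∑ i, (fun i y => s i • auxBump d (y - p i)) i y := rfl
    rw [this, iteratedFDeriv_fun_sum_apply (fun i _ => ((hcd i).const_smul (s i)).contDiffAt)]
    refine Finset.sum_congr rfl fun i _ => ?_
    rw [iteratedFDeriv_const_smul_apply' (hcd i).contDiffAt]
    rw [iteratedFDeriv_comp_sub]
  rw [h1]
  have hz : ∀ i, 1/3 < dist y (p i) → iteratedFDeriv ℝ j (auxBump d) (y - p i) = 0 := by
    intro i hi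
    by_contra hne
    have := support_iteratedFDeriv_subset j (Function.mem_support.2 hne)
    rw [ContDiffBump.tsupport_eq, mem_closedBall, dist_zero_right, ← dist_eq_norm] at this
    simp only [auxBump] at this
    linarith
  by_cases hex : ∃ i0, dist y (p i0) ≤ 1/3
  · obtain ⟨i0, h0⟩ := hex
    rw [Finset.sum_eq_single i0]
    · rw [norm_smul]
      calc _ ≤ 1 * M := by
            gcongr
            · exact hs i0
            · exact hM _
        _ = M := one_mul _
    · intro i _ hi
      rw [hz i, smul_zero]
      have := hp i i0 hi
      have := dist_triangle_left (p i) (p i0) y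
      linarith
    · simp
  · push Not at hex
    rw [Finset.sum_eq_zero]
    · simpa using hM0
    · intro i _
      rw [hz i (hex i), smul_zero]

theorem auxSum_abs_le {d : ℕ} {ι : Type} [Fintype ι] (p : ι → Fin d → ℝ) (s : ι → ℝ)
    (hp : ∀ i j, i ≠ j → 1 ≤ dist (p i) (p j)) (hs : ∀ i, |s i| ≤ 1) (y : Fin d → ℝ) :
    |auxSum p s y| ≤ 1 := by
  have := auxSum_bound p s hp hs 0 1 (fun x => by
    rw [norm_iteratedFDeriv_zero, Real.norm_eq_abs, abs_of_nonneg (auxBump d).nonneg]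
    exact (auxBump d).le_one) y
  rwa [norm_iteratedFDeriv_zero] at this

theorem auxSum_center {d : ℕ} {ι : Type} [Fintype ι] (p : ι → Fin d → ℝ) (s : ι → ℝ)
    (hp : ∀ i j, i ≠ j → 1 ≤ dist (p i) (p j)) (i : ι) :
    auxSum p s (p i) = s i := by
  classical
  unfold auxSum
  rw [Finset.sum_eq_single i]
  · rw [sub_self, (auxBump d).one_of_mem_closedBall (by simp [auxBump])]
    simp
  · intro j _ hj
    rw [(auxBump d).zero_of_le_dist, smul_zero]
    rw [dist_zero_right, ← dist_eq_norm]
    have := hp i j hj.symm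
    simp only [auxBump]
    linarith
  · simp

theorem min_le_rpow_aux {s α : ℝ} (hs : 0 ≤ s) (h0 : 0 ≤ α) (h1 : α ≤ 1) : min 1 s ≤ s ^ α := by
  rcases le_total 1 s with h | h
  · exact (min_le_left _ _).trans (Real.one_le_rpow h h0)
  · refine (min_le_right _ _).trans ?_
    rcases hs.eq_or_lt with rfl | hs
    · positivity
    · calc s = s ^ (1:ℝ) := (Real.rpow_one s).symm
        _ ≤ s ^ α := Real.rpow_le_rpow_of_exponent_ge hs h h1

theorem cube_uniqueDiff (d : ℕ) : UniqueDiffOn ℝ (Cube d) := by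
  refine uniqueDiffOn_convex (convex_Icc _ _) ?_
  refine ⟨fun _ => 1/2, ?_⟩
  rw [Cube, ← Set.pi_univ_Icc, interior_pi_set Set.finite_univ]
  intro i _
  simp only [Pi.zero_apply, Pi.one_apply, interior_Icc]
  constructor <;> norm_num

theorem series_mem_FSet (d k : ℕ) (α : ℝ) (hα : α ∈ Set.Icc (0:ℝ) 1)
    (g : ℕ → (Fin d → ℝ) → ℝ) (N a : ℕ → ℝ) (M : ℝ) (hM : 0 ≤ M) (hN : ∀ n, 1 ≤ N n)
    (ha : ∀ n, 0 ≤ a n)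
    (hg : ∀ n, ContDiff ℝ (k + 1 : ℕ) (g n))
    (hgb : ∀ n, ∀ j ≤ k + 1, ∀ x, ‖iteratedFDeriv ℝ j (g n) x‖ ≤ a n * (M * N n ^ j))
    (hsum : Summable fun n => a n * N n ^ ((k:ℝ) + α))
    (hle : 2 * M * ∑' n, a n * N n ^ ((k:ℝ) + α) ≤ 1) :
    ContDiff ℝ k (fun x => ∑' n, g n x) ∧ (fun x => ∑' n, g n x) ∈ FSet d k α := by
  have hb0 : ∀ n, 0 ≤ a n * N n ^ ((k:ℝ) + α) := fun n =>
    mul_nonneg (ha n) (Real.rpow_nonneg (zero_le_one.trans (hN n)) _)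
  have hS0 : 0 ≤ ∑' n, a n * N n ^ ((k:ℝ) + α) := tsum_nonneg hb0
  have hle1 : M * ∑' n, a n * N n ^ ((k:ℝ) + α) ≤ 1 := by
    have : 0 ≤ M * ∑' n, a n * N n ^ ((k:ℝ) + α) := mul_nonneg hM hS0
    linarith
  have hv : ∀ j ≤ k, ∀ n x, ‖iteratedFDeriv ℝ j (g n) x‖ ≤ M * (a n * N n ^ ((k:ℝ) + α)) := by
    intro j hj n x
    refine (hgb n j (by omega) x).trans ?_
    have : N n ^ j ≤ N n ^ ((k:ℝ) + α) := by
      rw [← Real.rpow_natCast]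
      refine Real.rpow_le_rpow_of_exponent_le (hN n) ?_
      have : (j:ℝ) ≤ k := by exact_mod_cast hj
      linarith [hα.1]
    calc a n * (M * N n ^ j) = M * (a n * N n ^ j) := by ring
      _ ≤ _ := by have := ha n; gcongr
  have hgk : ∀ n, ContDiff ℝ ((k : ℕ∞) : WithTop ℕ∞) (g n) := fun n =>
    (hg n).of_le (by exact_mod_cast Nat.le_succ k)
  have hsM : Summable fun n => M * (a n * N n ^ ((k:ℝ) + α)) := hsum.mul_left M
  have hcd : ContDiff ℝ ((k : ℕ∞) : WithTop ℕ∞) (fun x => ∑' n, g n x) :=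
    contDiff_tsum (v := fun _ n => M * (a n * N n ^ ((k:ℝ) + α))) hgk (fun _ _ => hsM)
      (fun j n x hj => hv j (by exact_mod_cast hj) n x)
  have hcd' : ContDiff ℝ k (fun x => ∑' n, g n x) := hcd
  have hit : ∀ j ≤ k, ∀ x, iteratedFDeriv ℝ j (fun x => ∑' n, g n x) x
      = ∑' n, iteratedFDeriv ℝ j (g n) x := by
    intro j hj x
    exact iteratedFDeriv_tsum_apply (v := fun _ n => M * (a n * N n ^ ((k:ℝ) + α))) hgk
      (fun _ _ => hsM) (fun j n x hj => hv j (by exact_mod_cast hj) n x)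
      (by exact_mod_cast hj) x
  have hbd : ∀ j ≤ k, ∀ x, ‖iteratedFDeriv ℝ j (fun x => ∑' n, g n x) x‖ ≤ 1 := by
    intro j hj x
    rw [hit j hj x]
    refine (tsum_of_norm_bounded hsM.hasSum (fun n => hv j hj n x)).trans ?_
    rwa [tsum_mul_left]
  have hw : ∀ j ≤ k, ∀ x ∈ Cube d, iteratedFDerivWithin ℝ j (fun x => ∑' n, g n x) (Cube d) x
      = iteratedFDeriv ℝ j (fun x => ∑' n, g n x) x := by
    intro j hj x hx
    exact iteratedFDerivWithin_eq_iteratedFDeriv (cube_uniqueDiff d)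
      (hcd'.of_le (by exact_mod_cast hj)).contDiffAt hx
  refine ⟨hcd', hcd'.contDiffOn, ?_, ?_, ?_⟩
  · intro x _
    have := hbd 0 (Nat.zero_le _) x
    rw [norm_iteratedFDeriv_zero, Real.norm_eq_abs] at this
    exact abs_le.1 this
  · intro j hj x hx
    rw [hw j hj x hx]
    exact hbd j hj x
  · intro _ x hx y hy
    rw [hw k le_rfl x hx, hw k le_rfl y hy, hit k le_rfl, hit k le_rfl]
    have hsx : ∀ x, Summable fun n => iteratedFDeriv ℝ k (g n) x := fun x =>
      Summable.of_norm_bounded hsM (fun n => hv k le_rfl n x)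
    rw [← (hsx x).tsum_sub (hsx y)]
    have hterm : ∀ n, ‖iteratedFDeriv ℝ k (g n) x - iteratedFDeriv ℝ k (g n) y‖ ≤
        (2 * M * (a n * N n ^ ((k:ℝ) + α))) * ‖x - y‖ ^ α := by
      intro n
      have hNp : 0 < N n := zero_lt_one.trans_le (hN n)
      have haM : 0 ≤ a n * (2 * M * N n ^ k) := by have := ha n; positivity
      have h1 : ‖iteratedFDeriv ℝ k (g n) x - iteratedFDeriv ℝ k (g n) y‖
          ≤ a n * (2 * M * N n ^ k) * 1 := by
        refine (norm_sub_le _ _).trans ?_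
        have h1 := hgb n k (by omega) x
        have h2 := hgb n k (by omega) y
        linarith
      have h2 : ‖iteratedFDeriv ℝ k (g n) x - iteratedFDeriv ℝ k (g n) y‖
          ≤ a n * (2 * M * N n ^ k) * (N n * ‖x - y‖) := by
        have h3 := Convex.norm_image_sub_le_of_norm_fderiv_le (𝕜 := ℝ)
          (f := iteratedFDeriv ℝ k (g n)) (s := univ) (C := a n * (M * N n ^ (k + 1)))
          (x := y) (y := x)
          (fun z _ => ((hg n).differentiable_iteratedFDeriv
            (by exact_mod_cast Nat.lt_succ_self k)) z)
          (fun z _ => by rw [norm_fderiv_iteratedFDeriv]; exact hgb n (k+1) le_rfl z)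
          convex_univ (mem_univ _) (mem_univ _)
        refine h3.trans ?_
        have : 0 ≤ a n * (M * N n ^ (k+1)) * ‖x - y‖ := by have := ha n; positivity
        calc a n * (M * N n ^ (k+1)) * ‖x - y‖
          ≤ 2 * (a n * (M * N n ^ (k+1)) * ‖x - y‖) := by linarith
          _ = _ := by ring
      have h3 : ‖iteratedFDeriv ℝ k (g n) x - iteratedFDeriv ℝ k (g n) y‖
          ≤ a n * (2 * M * N n ^ k) * min 1 (N n * ‖x - y‖) := by
        rw [mul_min_of_nonneg _ _ haM]; exact le_min h1 h2
      refine h3.trans ?_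
      calc a n * (2 * M * N n ^ k) * min 1 (N n * ‖x - y‖)
          ≤ a n * (2 * M * N n ^ k) * (N n * ‖x - y‖) ^ α := by
            gcongr
            exact min_le_rpow_aux (by positivity) hα.1 hα.2
        _ = _ := by
            rw [Real.mul_rpow hNp.le (norm_nonneg _), Real.rpow_add hNp, Real.rpow_natCast]
            ring
    have hs2 : Summable fun n => (2 * M * (a n * N n ^ ((k:ℝ) + α))) * ‖x - y‖ ^ α :=
      (hsum.mul_left _).mul_right _
    refine (tsum_of_norm_bounded hs2.hasSum hterm).trans ?_
    rw [tsum_mul_right, tsum_mul_left]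
    exact mul_le_of_le_one_left (by positivity) hle

theorem tail_aux (D : ℕ → ℝ) (c ρ : ℝ) (m : ℕ) (hc : 0 < c) (hρ : 0 < ρ) (hρ3 : ρ ≤ 1/3)
    (h0 : ∀ n < m, D n = 0) (h1 : |D m| = c * ρ ^ m) (h2 : ∀ n, |D n| ≤ c * ρ ^ n) :
    c * ρ ^ m / 2 ≤ |∑' n, D n| := by
  have hgeo : HasSum (fun n : ℕ => ρ ^ n) (1 - ρ)⁻¹ :=
    hasSum_geometric_of_lt_one hρ.le (by linarith)
  have hD : Summable D := Summable.of_norm_bounded (hgeo.summable.mul_left c) h2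
  have hsplit := hD.sum_add_tsum_nat_add (m + 1)
  rw [Finset.sum_range_succ, Finset.sum_eq_zero (fun n hn => h0 n (Finset.mem_range.1 hn)),
    zero_add] at hsplit
  have htail : |∑' n, D (n + (m + 1))| ≤ c * ρ ^ (m + 1) * (1 - ρ)⁻¹ := by
    rw [← Real.norm_eq_abs]
    refine tsum_of_norm_bounded (hgeo.mul_left (c * ρ ^ (m+1))) (fun n => ?_)
    refine (h2 _).trans (le_of_eq ?_)
    rw [pow_add ρ n]; ring
  have hb : c * ρ ^ (m + 1) * (1 - ρ)⁻¹ ≤ c * ρ ^ m / 2 := by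
    have : ρ * (1 - ρ)⁻¹ ≤ 1/2 := by
      rw [← div_eq_mul_inv, div_le_iff₀ (by linarith)]; linarith
    calc c * ρ ^ (m + 1) * (1 - ρ)⁻¹ = c * ρ ^ m * (ρ * (1 - ρ)⁻¹) := by ring
      _ ≤ c * ρ ^ m * (1/2) := by gcongr
      _ = _ := by ring
  rw [← hsplit]
  have := abs_sub_abs_le_abs_sub (D m) (-(∑' n, D (n + (m + 1))))
  rw [abs_neg, sub_neg_eq_add] at this
  linarith

/-- centers of the unit grid cells -/
def gridPt (d N : ℕ) (i : Fin d → Fin N) : Fin d → ℝ := fun l => ((i l : ℕ) : ℝ) + 1/2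

theorem gridPt_sep (d N : ℕ) (i j : Fin d → Fin N) (h : i ≠ j) :
    1 ≤ dist (gridPt d N i) (gridPt d N j) := by
  obtain ⟨l, hl⟩ := Function.ne_iff.1 h
  refine le_trans ?_ (dist_le_pi_dist _ _ l)
  simp only [gridPt, dist_add_right]
  have h1 : ((i l : ℕ) : ℤ) - ((j l : ℕ) : ℤ) ≠ 0 := by
    intro h; apply hl; apply Fin.ext; omega
  have h2 := Int.one_le_abs h1
  rw [Real.dist_eq]
  exact_mod_cast h2

/-- real-valued bits -/
def bits {ι : Type} (η : ι → Bool) (i : ι) : ℝ := if η i then 1 else 0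

theorem card_aux (d : ℕ) (L : ℕ) (q' β c : ℝ) (hL : 2 ≤ L) (hq' : 0 < q') (hβ : 0 < β)
    (hc : 0 < c) (hlt : q' * β < d) (A : ℝ) (hA : 0 < A) :
    ∀ᶠ m : ℕ in atTop, ∀ r : ℝ, c * ((L:ℝ) ^ (-q')) ^ (m + 1) / 4 < r →
      A ≤ Fintype.card ((Fin d → Fin (L ^ m)) → Bool) * ordFam β r := by
  have hL1 : (1:ℝ) < L := by exact_mod_cast (by omega : 1 < L)
  have hL0 : (0:ℝ) < L := by linarith
  set ρ : ℝ := (L:ℝ) ^ (-q') with hρdef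
  have hρ : 0 < ρ := Real.rpow_pos_of_pos hL0 _
  set K : ℝ := (c * ρ / 4) ^ (-β) with hK
  have hK0 : 0 < K := Real.rpow_pos_of_pos (by positivity) _
  set u : ℝ := (L:ℝ) ^ (q' * β) with hu
  have hu1 : 1 ≤ u := Real.one_le_rpow hL1.le (by positivity)
  have hu0 : 0 < u := by linarith
  have huv : u < (L:ℝ) ^ d := by
    rw [← Real.rpow_natCast]
    exact Real.rpow_lt_rpow_of_exponent_lt hL1 hlt
  have hv0 : 0 < (L:ℝ) ^ d := by positivity
  have hlog2 : 0 < Real.log 2 := Real.log_pos (by norm_num)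
  have hten : Tendsto (fun m : ℕ => (|Real.log A| + K) * (u / (L:ℝ) ^ d) ^ m) atTop (𝓝 0) := by
    have := (tendsto_pow_atTop_nhds_zero_of_lt_one (r := u / (L:ℝ) ^ d) (by positivity)
      (by rwa [div_lt_one hv0])).const_mul (|Real.log A| + K)
    simpa using this
  filter_upwards [hten.eventually (gt_mem_nhds hlog2)] with m hm r hr
  have hs0 : 0 < c * ρ ^ (m + 1) / 4 := by positivity
  have hrβ : r ^ (-β) ≤ K * u ^ m := by
    calc r ^ (-β) ≤ (c * ρ ^ (m + 1) / 4) ^ (-β) :=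
          Real.rpow_le_rpow_of_nonpos hs0 hr.le (by linarith)
      _ = ((c * ρ / 4) * ρ ^ m) ^ (-β) := by congr 1; ring
      _ = K * (ρ ^ m) ^ (-β) := by rw [Real.mul_rpow (by positivity) (by positivity)]
      _ = K * u ^ m := by
          congr 1
          rw [hρdef, hu, ← Real.rpow_natCast, ← Real.rpow_natCast, ← Real.rpow_mul hL0.le,
            ← Real.rpow_mul hL0.le, ← Real.rpow_mul hL0.le]
          congr 1; ring
  have hmain : Real.log A + K * u ^ m ≤ Real.log 2 * ((L:ℝ) ^ d) ^ m := by
    rw [div_pow, ← mul_div_assoc, div_lt_iff₀ (by positivity)] at hm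
    have h1 : 1 ≤ u ^ m := one_le_pow₀ hu1
    have h2 : Real.log A ≤ |Real.log A| * u ^ m :=
      (le_abs_self _).trans (le_mul_of_one_le_right (abs_nonneg _) h1)
    linarith
  have hcard : (Fintype.card ((Fin d → Fin (L ^ m)) → Bool) : ℝ)
      = Real.exp (Real.log 2 * ((L:ℝ) ^ d) ^ m) := by
    simp only [Fintype.card_fun, Fintype.card_bool, Fintype.card_fin]
    rw [mul_comm, Nat.cast_pow, Nat.cast_ofNat, ← Real.rpow_natCast,
      Real.rpow_def_of_pos (by norm_num), mul_comm]
    congr 2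
    push_cast
    rw [← pow_mul, ← pow_mul, mul_comm]
  rw [hcard, ordFam, ← Real.exp_add]
  calc A = Real.exp (Real.log A) := (Real.exp_log hA).symm
    _ ≤ _ := Real.exp_le_exp.2 (by linarith)

theorem aux_main (d k : ℕ) (α β : ℝ) (hα : α ∈ Set.Icc (0:ℝ) 1)
    (hkα : 0 < (k : ℝ) + α) (hβ : 0 < β) (hlt : ((k:ℝ) + α) * β < d) :
    hausdorffMeasureOf (ordFam β) (FSpace d k α) = ⊤ := by
  -- parameters
  obtain ⟨q', hq1, hq2⟩ : ∃ q' : ℝ, (k:ℝ) + α < q' ∧ q' < d / β :=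
    exists_between ((lt_div_iff₀ hβ).2 hlt)
  have hq2' : q' * β < d := (lt_div_iff₀ hβ).1 hq2
  have hq0 : 0 < q' := hkα.trans hq1
  obtain ⟨L, hL, hL3⟩ : ∃ L : ℕ, 2 ≤ L ∧ (L:ℝ) ^ (-q') ≤ 1/3 := by
    have h1 := ((tendsto_rpow_neg_atTop hq0).comp tendsto_natCast_atTop_atTop).eventually
      (gt_mem_nhds (show (0:ℝ) < 1/3 by norm_num))
    obtain ⟨L, h2, h3⟩ := ((eventually_ge_atTop 2).and h1).exists
    exact ⟨L, h2, h3.le⟩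
  have hL1 : (1:ℝ) < L := by exact_mod_cast (by omega : 1 < L)
  have hL0 : (0:ℝ) < L := by linarith
  obtain ⟨ρ, hρdef⟩ : ∃ ρ : ℝ, ρ = (L:ℝ) ^ (-q') := ⟨_, rfl⟩
  have hρ : 0 < ρ := hρdef ▸ Real.rpow_pos_of_pos hL0 _
  have hρ3 : ρ ≤ 1/3 := hρdef ▸ hL3
  obtain ⟨θ, hθdef⟩ : ∃ θ : ℝ, θ = ρ * (L:ℝ) ^ ((k:ℝ) + α) := ⟨_, rfl⟩
  have hθ0 : 0 ≤ θ := by rw [hθdef]; positivity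
  have hθ1 : θ < 1 := by
    rw [hθdef, hρdef, ← Real.rpow_add hL0]
    exact Real.rpow_lt_one_of_one_lt_of_neg hL1 (by linarith)
  choose Mj hMj using auxBump_bound d
  obtain ⟨M, hM0, hM⟩ : ∃ M : ℝ, 0 < M ∧ ∀ j ≤ k + 1, Mj j ≤ M := by
    refine ⟨1 + ∑ j ∈ Finset.range (k + 2), |Mj j|, by positivity, fun j hj => ?_⟩
    have := Finset.single_le_sum (f := fun j => |Mj j|) (fun i _ => abs_nonneg _)
      (Finset.mem_range.2 (by omega : j < k + 2))
    have h2 := le_abs_self (Mj j)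
    linarith
  obtain ⟨c, hcdef⟩ : ∃ c : ℝ, c = (1 - θ) / (2 * M) := ⟨_, rfl⟩
  have hc : 0 < c := by rw [hcdef]; apply div_pos <;> linarith
  -- the functions
  let Y : ℕ → Type := fun n => (Fin d → Fin (L ^ n)) → Bool
  let G : ∀ n, Y n → (Fin d → ℝ) → ℝ := fun n η =>
    auxSum (gridPt d (L ^ n)) (bits η)
  let g : (∀ n, Y n) → ℕ → (Fin d → ℝ) → ℝ := fun w n x =>
    (c * ρ ^ n) • G n (w n) (((L:ℝ) ^ n) • x)
  have hbits : ∀ n (η : Y n) i, |bits η i| ≤ 1 := by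
    intro n η i; unfold bits; split_ifs <;> simp
  have hfam : ∀ w, ContDiff ℝ k (fun x => ∑' n, g w n x) ∧
      (fun x => ∑' n, g w n x) ∈ FSet d k α := by
    intro w
    have hb : ∀ n, c * ρ ^ n * ((L:ℝ) ^ n) ^ ((k:ℝ) + α) = c * θ ^ n := by
      intro n
      rw [hθdef, mul_pow, ← Real.rpow_natCast (L:ℝ) n, ← Real.rpow_mul hL0.le,
        mul_comm (n:ℝ), Real.rpow_mul hL0.le, Real.rpow_natCast, mul_assoc]
    have hgeo := hasSum_geometric_of_lt_one hθ0 hθ1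
    refine series_mem_FSet d k α hα (g w) (fun n => (L:ℝ) ^ n) (fun n => c * ρ ^ n) M hM0.le
      (fun n => one_le_pow₀ hL1.le) (fun n => by positivity) ?_ ?_ ?_ ?_
    · intro n
      refine ContDiff.const_smul _ ?_
      exact (auxSum_contDiff _ _ ((k + 1 : ℕ) : ℕ∞)).comp (contDiff_id.const_smul _)
    · intro n j hj x
      have h1 : ContDiff ℝ j (G n (w n)) := auxSum_contDiff _ _ (j : ℕ∞)
      have h2 : ContDiff ℝ j (fun x => G n (w n) (((L:ℝ) ^ n) • x)) :=
        h1.comp (contDiff_id.const_smul _)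
      have h3 : iteratedFDeriv ℝ j (g w n) x
          = (c * ρ ^ n) • (((L:ℝ) ^ n) ^ j • iteratedFDeriv ℝ j (G n (w n)) (((L:ℝ) ^ n) • x)) := by
        change iteratedFDeriv ℝ j (fun x => (c * ρ ^ n) • G n (w n) (((L:ℝ) ^ n) • x)) x = _
        rw [iteratedFDeriv_const_smul_apply' h2.contDiffAt, iteratedFDeriv_comp_const_smul _ h1]
      rw [h3, norm_smul, norm_smul, Real.norm_of_nonneg (by positivity : 0 ≤ c * ρ ^ n),
        Real.norm_of_nonneg (by positivity : 0 ≤ ((L:ℝ) ^ n) ^ j), mul_comm M]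
      gcongr
      exact (auxSum_bound _ _ (gridPt_sep d _) (hbits n (w n)) j _ (hMj j) _).trans (hM j hj)
    · simp only [hb]
      exact hgeo.summable.mul_left c
    · simp only [hb]
      rw [tsum_mul_left, hgeo.tsum_eq, hcdef]
      have : 1 - θ ≠ 0 := by linarith
      apply le_of_eq
      field_simp
  let F : (∀ n, Y n) → C(Cube d, ℝ) := fun w =>
    ⟨fun x => ∑' n, g w n x, (hfam w).1.continuous.comp continuous_subtype_val⟩
  refine aux_mass (FSpace d k α) (ordFam β) Y F (fun w => ⟨_, (hfam w).2, fun x => rfl⟩) c ρ hc hρ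
    (by linarith) ?_ ?_
  · intro w w' m hm
    have hex : ∃ m, w m ≠ w' m := ⟨m, hm⟩
    classical
    obtain ⟨m1, hm1, hm1', hmin⟩ : ∃ m1, w m1 ≠ w' m1 ∧ m1 ≤ m ∧ ∀ n < m1, w n = w' n :=
      ⟨Nat.find hex, Nat.find_spec hex, Nat.find_min' hex hm,
        fun n hn => not_not.1 (Nat.find_min hex hn)⟩
    have hle : c * ρ ^ m / 2 ≤ c * ρ ^ m1 / 2 := by
      have := pow_le_pow_of_le_one hρ.le (by linarith : ρ ≤ 1) hm1'
      gcongr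
    refine hle.trans ?_
    obtain ⟨i, hi⟩ := Function.ne_iff.1 hm1
    have hLm : (0:ℝ) < (L:ℝ) ^ m1 := by positivity
    let x : Fin d → ℝ := ((L:ℝ) ^ m1)⁻¹ • gridPt d (L ^ m1) i
    have hxs : ((L:ℝ) ^ m1) • x = gridPt d (L ^ m1) i := smul_inv_smul₀ hLm.ne' _
    have hx : x ∈ Cube d := by
      constructor
      · intro l
        simp only [x, Pi.smul_apply, gridPt, Pi.zero_apply, smul_eq_mul]
        positivity
      · intro l
        simp only [x, Pi.smul_apply, gridPt, Pi.one_apply, smul_eq_mul]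
        rw [inv_mul_le_iff₀ hLm, mul_one]
        have h1 : ((i l : ℕ) : ℝ) + 1 ≤ (L:ℝ) ^ m1 := by
          exact_mod_cast (i l).isLt
        linarith
    refine le_trans ?_ (ContinuousMap.dist_apply_le_dist (⟨x, hx⟩ : Cube d))
    have hgle : ∀ w n x, ‖g w n x‖ ≤ c * ρ ^ n := by
      intro w n x
      simp only [g, norm_smul]
      rw [Real.norm_of_nonneg (by positivity : 0 ≤ c * ρ ^ n)]
      exact mul_le_of_le_one_right (by positivity)
        (auxSum_abs_le _ _ (gridPt_sep d _) (hbits n (w n)) _)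
    have hsumm : ∀ w, Summable fun n => g w n x := fun w =>
      Summable.of_norm_bounded
        ((summable_geometric_of_lt_one hρ.le (by linarith)).mul_left c) (fun n => hgle w n x)
    have hF : dist (F w ⟨x, hx⟩) (F w' ⟨x, hx⟩) = |∑' n, (g w n x - g w' n x)| := by
      rw [(hsumm w).tsum_sub (hsumm w'), Real.dist_eq]; rfl
    rw [hF]
    refine tail_aux _ c ρ m1 hc hρ hρ3 ?_ ?_ ?_
    · intro n hn
      simp only [g, hmin n hn, sub_self]
    · simp only [g, hxs, G]
      rw [auxSum_center _ _ (gridPt_sep d _), auxSum_center _ _ (gridPt_sep d _), ← smul_sub,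
        smul_eq_mul, abs_mul, abs_of_pos (by positivity : 0 < c * ρ ^ m1)]
      have : |bits (w m1) i - bits (w' m1) i| = 1 := by
        unfold bits
        cases h1 : w m1 i <;> cases h2 : w' m1 i <;> simp_all
      rw [this, mul_one]
    · intro n
      have h1 : g w n x - g w' n x = (c * ρ ^ n) • auxSum (gridPt d (L ^ n))
          (fun i => bits (w n) i - bits (w' n) i) (((L:ℝ) ^ n) • x) := by
        simp only [g, G, auxSum, ← smul_sub, ← Finset.sum_sub_distrib, ← sub_smul]
      rw [h1, smul_eq_mul, abs_mul, abs_of_pos (by positivity : 0 < c * ρ ^ n)]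
      refine mul_le_of_le_one_right (by positivity) (auxSum_abs_le _ _ (gridPt_sep d _) ?_ _)
      intro i
      unfold bits
      split_ifs <;> simp
  · intro A hA
    rw [hρdef]
    exact card_aux d L q' β c hL hq0 hβ hc hq2' A hA

/-- The Hausdorff order of `𝓕^{d,k,α}` is at least `d/(k+α)`. -/
theorem hausdorff_order_FSpace_ge (d k : ℕ) (hd : 1 ≤ d) (α : ℝ)
    (hα : α ∈ Set.Icc (0:ℝ) 1) (hkα : 0 < (k : ℝ) + α) :
    ENNReal.ofReal ((d : ℝ) / ((k : ℝ) + α)) ≤ hausdorffScale ordFam (FSpace d k α) := by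
  refine le_of_forall_lt fun b hb => ?_
  have hbt : b ≠ ⊤ := (hb.trans ENNReal.ofReal_lt_top).ne
  have hb2 : b.toReal < (d : ℝ) / ((k : ℝ) + α) := (ENNReal.lt_ofReal_iff_toReal_lt hbt).1 hb
  obtain ⟨β, h1, h2⟩ := exists_between hb2
  have hβ : 0 < β := ENNReal.toReal_nonneg.trans_lt h1
  have hH := aux_main d k α β hα hkα hβ (by rw [lt_div_iff₀ hkα] at h2; linarith)
  refine lt_of_lt_of_le ((ENNReal.lt_ofReal_iff_toReal_lt hbt).2 h1) ?_
  unfold hausdorffScale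
  exact le_iSup₂ (f := fun (α' : ℝ) (_ : 0 < α' ∧
    hausdorffMeasureOf (ordFam α') (FSpace d k α) = ⊤) => ENNReal.ofReal α') β ⟨hβ, hH⟩

end
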